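/- Let (X,d) be a complete metric space equipped with a Borel regular doubling measure μ with constant C_d ≥ 1, let Ω ⊂ X be a uniform domain with constant c_U ∈ (0,1] and X∖Ω ≠ ∅, and let 0 < c_H < 1. Then M^{1,1}_{c_H}(Ω) = M^{1,1}(Ω) as sets, with equivalent norms: there is a constant C ≥ 1 depending only on C_d, c_U, and c_H such that ‖u‖_{M^{1,1}(Ω)} ≤ C·‖u‖_{M^{1,1}_{c_H}(Ω)} for every u ∈ M^{1,1}_{c_H}(Ω) (the reverse inequality ‖u‖_{M^{1,1}_{c_H}(Ω)} ≤ ‖u‖_{M^{1,1}(Ω)} being immediate). -/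

import Mathlib

open Metric MeasureTheory

/-- A domain `Ω` is uniform with constant `c_U ∈ (0,1]` if every pair of distinct
points `x, y ∈ Ω` can be joined by an arc-length parametrized (i.e. `1`-Lipschitz)
curve `γ : [0, L] → Ω` with `γ 0 = x`, `γ L = y`, `L ≤ c_U⁻¹ d(x,y)` and
`dist(γ t, X∖Ω) ≥ c_U min{t, L - t}` for all `t ∈ [0, L]`. -/
def IsUniformDomain {X : Type*} [MetricSpace X] (Ω : Set X) (cU : ℝ) : Prop :=
  ∀ x ∈ Ω, ∀ y ∈ Ω, x ≠ y →
    ∃ (γ : ℝ → X) (L : ℝ), 0 ≤ L ∧ γ 0 = x ∧ γ L = y ∧ L ≤ cU⁻¹ * dist x y ∧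
      (∀ t ∈ Set.Icc (0 : ℝ) L, γ t ∈ Ω) ∧
      LipschitzOnWith 1 γ (Set.Icc (0 : ℝ) L) ∧
      ∀ t ∈ Set.Icc (0 : ℝ) L, cU * min t (L - t) ≤ infDist (γ t) Ωᶜ

/-- `g` is an admissible Hajłasz gradient of `u` on `Ω`: `g ≥ 0`, `g ∈ L¹(Ω)`, and the
Hajłasz inequality holds off a `μ`-null set `A ⊆ Ω`. -/
def HajlaszAdmissible {X : Type*} [MetricSpace X] [MeasurableSpace X]
    (μ : Measure X) (Ω : Set X) (u g : X → ℝ) : Prop :=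
  (∀ p, 0 ≤ g p) ∧ IntegrableOn g Ω μ ∧
    ∃ A : Set X, A ⊆ Ω ∧ μ A = 0 ∧
      ∀ x ∈ Ω \ A, ∀ y ∈ Ω \ A, |u x - u y| ≤ dist x y * (g x + g y)

/-- `g` is an admissible restricted Hajłasz gradient of `u` on `Ω` with parameter
`c_H`: as above, but the Hajłasz inequality is only required for points with
`d(x,y) ≤ c_H min{dist(x,X∖Ω), dist(y,X∖Ω)}`. -/
def HajlaszAdmissibleLoc {X : Type*} [MetricSpace X] [MeasurableSpace X]
    (μ : Measure X) (Ω : Set X) (cH : ℝ) (u g : X → ℝ) : Prop :=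
  (∀ p, 0 ≤ g p) ∧ IntegrableOn g Ω μ ∧
    ∃ A : Set X, A ⊆ Ω ∧ μ A = 0 ∧
      ∀ x ∈ Ω \ A, ∀ y ∈ Ω \ A,
        dist x y ≤ cH * min (infDist x Ωᶜ) (infDist y Ωᶜ) →
        |u x - u y| ≤ dist x y * (g x + g y)

section HajlaszLoc

open Set
open scoped ENNReal

variable {X : Type*} [MetricSpace X]

/-- Chaining along a curve: if `u` has restricted Hajłasz gradient `g` off `A`, and
near every point `γ t` of a `1`-Lipschitz curve in `Ω` a point `z t ∉ A` with `g (z t) ≤ M` is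
chosen, then `|u (z L) - u (z 0)|` is controlled by `M` times the length plus the maximal distance
to the complement. -/
theorem abs_sub_le_of_chain {Ω A : Set X} {cH : ℝ} (hcH : cH ∈ Ioo (0 : ℝ) 1)
    {u g : X → ℝ}
    (hu : ∀ x ∈ Ω \ A, ∀ y ∈ Ω \ A,
      dist x y ≤ cH * min (infDist x Ωᶜ) (infDist y Ωᶜ) → |u x - u y| ≤ dist x y * (g x + g y))
    {γ : ℝ → X} {L Δ M η : ℝ} (hM : 0 ≤ M) (hη : 0 < η)
    (hγ : LipschitzOnWith 1 γ (Icc (0 : ℝ) L))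
    (hηγ : ∀ t ∈ Icc (0 : ℝ) L, η ≤ infDist (γ t) Ωᶜ)
    (hΔ : ∀ t ∈ Icc (0 : ℝ) L, infDist (γ t) Ωᶜ ≤ Δ)
    {z : ℝ → X} (hzΩ : ∀ t ∈ Icc (0 : ℝ) L, z t ∈ Ω \ A)
    (hzγ : ∀ t ∈ Icc (0 : ℝ) L, dist (z t) (γ t) ≤ cH / 16 * infDist (γ t) Ωᶜ)
    (hzM : ∀ t ∈ Icc (0 : ℝ) L, g (z t) ≤ M) (hL : 0 ≤ L) :
    |u (z L) - u (z 0)| ≤ 8 * M * L + M * Δ := by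
  obtain ⟨h0, h1⟩ := hcH
  have key : ∀ t ∈ Icc (0 : ℝ) L, ∀ s ∈ Icc (0 : ℝ) L, |t - s| ≤ cH / 16 * infDist (γ t) Ωᶜ →
      |u (z t) - u (z s)| ≤ 8 * M * (cH / 16 * infDist (γ t) Ωᶜ) := by
    intro t ht s hs hts
    have hd : dist (γ t) (γ s) ≤ |t - s| := by
      simpa [Real.dist_eq] using hγ.dist_le_mul t ht s hs
    have hzt := hzγ t ht
    have hzs := hzγ s hs
    have hpos := hη.trans_le (hηγ t ht)
    have e1 : infDist (γ s) Ωᶜ ≤ infDist (γ t) Ωᶜ + dist (γ s) (γ t) :=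
      infDist_le_infDist_add_dist
    have e2 : infDist (γ t) Ωᶜ ≤ infDist (γ s) Ωᶜ + dist (γ t) (γ s) :=
      infDist_le_infDist_add_dist
    have e3 : infDist (γ t) Ωᶜ ≤ infDist (z t) Ωᶜ + dist (γ t) (z t) :=
      infDist_le_infDist_add_dist
    have e4 : infDist (γ s) Ωᶜ ≤ infDist (z s) Ωᶜ + dist (γ s) (z s) :=
      infDist_le_infDist_add_dist
    rw [dist_comm] at e1 e3 e4
    set p := infDist (γ t) Ωᶜ
    set q := infDist (γ s) Ωᶜ
    have f1 : cH / 16 * p ≤ p / 16 := by nlinarith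
    have f2 : q ≤ 2 * p := by linarith
    have f3 : cH / 16 * q ≤ cH / 16 * (2 * p) := by gcongr
    have hdz : dist (z t) (z s) ≤ 4 * (cH / 16 * p) := by
      have := dist_triangle4 (z t) (γ t) (γ s) (z s)
      rw [dist_comm (γ s)] at this
      linarith
    have hmin : p / 4 ≤ min (infDist (z t) Ωᶜ) (infDist (z s) Ωᶜ) :=
      le_min (by linarith) (by linarith)
    have := hu _ (hzΩ t ht) _ (hzΩ s hs) (by nlinarith)
    calc |u (z t) - u (z s)| ≤ dist (z t) (z s) * (g (z t) + g (z s)) := this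
      _ ≤ dist (z t) (z s) * (M + M) := by gcongr <;> [exact hzM t ht; exact hzM s hs]
      _ ≤ 4 * (cH / 16 * p) * (M + M) := by gcongr
      _ = _ := by ring
  have hη' : 0 < cH / 16 * η := by positivity
  have ind : ∀ n : ℕ, ∀ t ∈ Icc (0 : ℝ) L, t ≤ n * (cH / 16 * η) →
      |u (z t) - u (z 0)| ≤ 8 * M * t + M * Δ := by
    intro n
    induction n with
    | zero =>
      intro t ht htn
      have : t = 0 := le_antisymm (by simpa using htn) ht.1
      subst this
      have := (hη.le.trans (hηγ _ ht)).trans (hΔ _ ht)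
      simp only [sub_self, abs_zero, mul_zero, zero_add]
      positivity
    | succ n ih =>
      intro t ht htn
      have hge : cH / 16 * η ≤ cH / 16 * infDist (γ t) Ωᶜ := by gcongr; exact hηγ t ht
      rcases le_or_gt t (cH / 16 * infDist (γ t) Ωᶜ) with hle | hlt
      · have := key t ht 0 ⟨le_rfl, hL⟩ (by rwa [sub_zero, abs_of_nonneg ht.1])
        have hpos := hη.le.trans (hηγ t ht)
        have h2 : 8 * M * (cH / 16 * infDist (γ t) Ωᶜ) ≤ 8 * M * (1 / 8 * Δ) := by
          gcongr ?_ * ?_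
          nlinarith [hΔ t ht]
        have h3 : 0 ≤ 8 * M * t := mul_nonneg (by positivity) ht.1
        linarith
      · set s := t - cH / 16 * infDist (γ t) Ωᶜ with hs
        have hsI : s ∈ Icc (0 : ℝ) L := ⟨by linarith, by linarith [ht.2]⟩
        have k1 := key t ht s hsI (by
          rw [hs, sub_sub_cancel, abs_of_nonneg (hη'.le.trans hge)])
        have k2 := ih s hsI (by push_cast at htn; linarith)
        have k3 := abs_sub_le (u (z t)) (u (z s)) (u (z 0))
        have k4 : cH / 16 * infDist (γ t) Ωᶜ = t - s := by rw [hs]; ring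
        rw [k4] at k1
        linarith
  obtain ⟨n, hn⟩ := exists_nat_ge (L / (cH / 16 * η))
  exact ind n L ⟨hL, le_rfl⟩ (by rwa [div_le_iff₀ hη'] at hn)

variable [MeasurableSpace X]

theorem sigmaFinite_of_measure_ball_lt_top {μ : Measure X}
    (h : ∀ (x : X) (r : ℝ), 0 < r → μ (ball x r) < ⊤) : SigmaFinite μ := by
  rcases isEmpty_or_nonempty X with hX | ⟨⟨x⟩⟩
  · rw [μ.eq_zero_of_isEmpty]; infer_instance
  · refine ⟨⟨⟨fun n => ball x (n + 1), fun _ => trivial, fun n => h x _ (by positivity), ?_⟩⟩⟩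
    refine eq_univ_of_forall fun y => mem_iUnion.2 ?_
    obtain ⟨n, hn⟩ := exists_nat_gt (dist y x)
    exact ⟨n, by rw [mem_ball]; linarith⟩

theorem secondCountableTopology_of_measure_ball [BorelSpace X] {μ : Measure X}
    (h : ∀ (x : X) (r : ℝ), 0 < r → 0 < μ (ball x r) ∧ μ (ball x r) < ⊤) :
    SecondCountableTopology X := by
  have := sigmaFinite_of_measure_ball_lt_top fun x r hr => (h x r hr).2
  refine Metric.secondCountable_of_almost_dense_set fun ε hε => ?_
  obtain ⟨s, -, hdisj, hcov⟩ := Vitali.exists_disjoint_subfamily_covering_enlargement_closedBall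
    (univ : Set X) id (fun _ => ε / 4) (ε / 4) (fun _ _ => le_rfl) 4 (by norm_num)
  refine ⟨s, ?_, fun x => ?_⟩
  · have hc := Measure.countable_meas_pos_of_disjoint_iUnion (μ := μ)
      (As := fun a : s => closedBall (a : X) (ε / 4)) (fun _ => isClosed_closedBall.measurableSet)
      (fun a b hab => hdisj a.2 b.2 (Subtype.coe_injective.ne hab))
    have : {a : s | 0 < μ (closedBall (a : X) (ε / 4))} = univ := eq_univ_of_forall fun a =>
      (h a (ε / 4) (by positivity)).1.trans_le (measure_mono ball_subset_closedBall)
    rw [this] at hc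
    exact countable_coe_iff.1 (countable_univ_iff.1 hc)
  · obtain ⟨b, hb, hsub⟩ := hcov x (mem_univ x)
    refine ⟨b, hb, ?_⟩
    have : x ∈ closedBall b (4 * (ε / 4)) := hsub (mem_closedBall_self (by positivity))
    rw [mem_closedBall] at this
    linarith

theorem measure_ball_two_pow_mul_le {μ : Measure X} {D : ℝ≥0∞}
    (h : ∀ (x : X) (r : ℝ), 0 < r → μ (ball x (2 * r)) ≤ D * μ (ball x r))
    (x : X) {r : ℝ} (hr : 0 < r) (n : ℕ) : μ (ball x (2 ^ n * r)) ≤ D ^ n * μ (ball x r) := by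
  induction n with
  | zero => simp
  | succ n ih =>
    calc μ (ball x (2 ^ (n + 1) * r)) = μ (ball x (2 * (2 ^ n * r))) := by ring_nf
      _ ≤ D * μ (ball x (2 ^ n * r)) := h x _ (by positivity)
      _ ≤ D * (D ^ n * μ (ball x r)) := by gcongr
      _ = _ := by ring

/-- The Whitney potential of `f`: the integral over the points `z ∈ Ω` whose Whitney ball,
enlarged by `K`, contains `x`, of `f z` divided by the measure of that Whitney ball. -/
noncomputable def whitneyPotential (μ : Measure X) (Ω : Set X) (K : ℝ) (f : X → ℝ≥0∞) (x : X) :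
    ℝ≥0∞ :=
  ∫⁻ z in Ω, {z | dist x z ≤ K * infDist z Ωᶜ}.indicator
    (fun z => f z / μ (ball z (infDist z Ωᶜ))) z ∂μ

section Measurability

variable [BorelSpace X] [SecondCountableTopology X] {μ : Measure X} [SigmaFinite μ]

theorem measurable_measure_ball_infDist (s : Set X) :
    Measurable fun z => μ (ball z (infDist z s)) := by
  have hs : MeasurableSet {p : X × X | dist p.2 p.1 < infDist p.1 s} :=
    measurableSet_lt (measurable_snd.dist measurable_fst)
      ((continuous_infDist_pt s).measurable.comp measurable_fst)
  exact measurable_measure_prodMk_left hs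

theorem measurable_whitneyPotential_kernel (Ω : Set X) (K : ℝ) {f : X → ℝ≥0∞}
    (hf : Measurable f) :
    Measurable fun p : X × X => {z | dist p.1 z ≤ K * infDist z Ωᶜ}.indicator
      (fun z => f z / μ (ball z (infDist z Ωᶜ))) p.2 := by
  have hs : MeasurableSet {p : X × X | dist p.1 p.2 ≤ K * infDist p.2 Ωᶜ} :=
    measurableSet_le (measurable_fst.dist measurable_snd)
      (((continuous_infDist_pt Ωᶜ).measurable.comp measurable_snd).const_mul K)
  exact Measurable.indicator
    ((hf.div (measurable_measure_ball_infDist Ωᶜ)).comp measurable_snd) hs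

theorem measurable_whitneyPotential (Ω : Set X) (K : ℝ) {f : X → ℝ≥0∞}
    (hf : Measurable f) : Measurable (whitneyPotential μ Ω K f) :=
  (measurable_whitneyPotential_kernel Ω K hf).lintegral_prod_right'

/-- The Whitney potential is bounded on `L¹`. -/
theorem lintegral_whitneyPotential_le {D : ℝ≥0∞}
    (h : ∀ (x : X) (r : ℝ), 0 < r → μ (ball x (2 * r)) ≤ D * μ (ball x r))
    {Ω : Set X} (hΩ : IsOpen Ω) (hΩc : Ωᶜ.Nonempty) {K : ℝ} {k : ℕ} (hk : K < 2 ^ k)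
    {f : X → ℝ≥0∞} (hf : Measurable f) :
    ∫⁻ x in Ω, whitneyPotential μ Ω K f x ∂μ ≤ D ^ k * ∫⁻ z in Ω, f z ∂μ := by
  unfold whitneyPotential
  rw [lintegral_lintegral_swap (measurable_whitneyPotential_kernel Ω K hf).aemeasurable,
    ← lintegral_const_mul _ hf]
  refine setLIntegral_mono (hf.const_mul _) fun z hz => ?_
  have hpos : 0 < infDist z Ωᶜ :=
    (hΩ.isClosed_compl.notMem_iff_infDist_pos hΩc).1 fun hz' => hz' hz
  set b := μ (ball z (infDist z Ωᶜ))
  calc ∫⁻ x in Ω, {z | dist x z ≤ K * infDist z Ωᶜ}.indicator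
        (fun z => f z / μ (ball z (infDist z Ωᶜ))) z ∂μ
      ≤ ∫⁻ x, (closedBall z (K * infDist z Ωᶜ)).indicator (fun _ => f z / b) x ∂μ :=
        setLIntegral_le_lintegral _ _
    _ = f z / b * μ (closedBall z (K * infDist z Ωᶜ)) := by
        rw [lintegral_indicator_const isClosed_closedBall.measurableSet]
    _ ≤ f z / b * (D ^ k * b) := by
        gcongr
        refine (measure_mono (closedBall_subset_ball ?_)).trans
          (measure_ball_two_pow_mul_le h z hpos k)
        gcongr
    _ = D ^ k * f z * (b⁻¹ * b) := by rw [div_eq_mul_inv]; ring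
    _ ≤ D ^ k * f z := mul_le_of_le_one_right' (ENNReal.inv_mul_le_one b)

end Measurability

/-- Each ball of radius comparable to the distance to the complement contains points, off a given
null set, at which `f` is controlled by its Whitney potential. -/
theorem exists_le_whitneyPotential [BorelSpace X] {μ : Measure X} {D : ℝ≥0∞}
    (hD : D ≠ ⊤) (h : ∀ (x : X) (r : ℝ), 0 < r →
      0 < μ (ball x r) ∧ μ (ball x (2 * r)) ≤ D * μ (ball x r) ∧ μ (ball x r) < ⊤)
    {Ω N : Set X} (hΩ : IsOpen Ω) (hΩc : Ωᶜ.Nonempty) (hN : μ N = 0) {ε a : ℝ} {m : ℕ}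
    (hε : 0 < ε) (hε' : ε ≤ 1 / 2) (hm : 2 ≤ 2 ^ m * ε)
    {f : X → ℝ≥0∞} (hf : Measurable f) {x p : X} (hp : p ∈ Ω)
    (ha : 0 ≤ a) (hxp : dist x p ≤ a * infDist p Ωᶜ) :
    ∃ z ∈ ball p (ε * infDist p Ωᶜ), z ∉ N ∧
      f z ≤ D ^ m * whitneyPotential μ Ω (2 * (a + 1)) f x := by
  have hpos : 0 < infDist p Ωᶜ :=
    (hΩ.isClosed_compl.notMem_iff_infDist_pos hΩc).1 fun hp' => hp' hp
  set r := ε * infDist p Ωᶜ with hr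
  have hr0 : 0 < r := by positivity
  have hr1 : r ≤ infDist p Ωᶜ / 2 := by nlinarith
  obtain ⟨hB0, -, hBtop⟩ := h p r hr0
  have hBm : MeasurableSet (ball p r) := isOpen_ball.measurableSet
  have : IsFiniteMeasure (μ.restrict (ball p r)) := ⟨by simpa using hBtop⟩
  obtain ⟨z, hz, hfz⟩ := exists_notMem_null_le_laverage (μ := μ.restrict (ball p r))
    (N := N ∪ (ball p r)ᶜ) (f := f) (by simpa using hB0.ne') hf.aemeasurable
    (measure_union_null (Measure.absolutelyContinuous_of_le Measure.restrict_le_self hN)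
      (by rw [Measure.restrict_apply hBm.compl]; simp))
  simp only [mem_union, mem_compl_iff, not_or, not_not] at hz
  refine ⟨z, hz.2, hz.1, hfz.trans ?_⟩
  rw [setLAverage_eq]
  refine ENNReal.div_le_of_le_mul ?_
  have hsub : ball p r ⊆ Ω := (ball_subset_ball (by linarith)).trans ball_infDist_compl_subset
  calc ∫⁻ w in ball p r, f w ∂μ
      ≤ ∫⁻ w in ball p r, D ^ m * μ (ball p r) *
          {w | dist x w ≤ 2 * (a + 1) * infDist w Ωᶜ}.indicator
            (fun w => f w / μ (ball w (infDist w Ωᶜ))) w ∂μ := by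
        refine setLIntegral_mono' hBm fun w hw => ?_
        rw [mem_ball] at hw
        have e1 : infDist p Ωᶜ ≤ infDist w Ωᶜ + dist p w := infDist_le_infDist_add_dist
        have e2 : infDist w Ωᶜ ≤ infDist p Ωᶜ + dist w p := infDist_le_infDist_add_dist
        rw [dist_comm] at e1
        have hwpos : 0 < infDist w Ωᶜ := by linarith
        obtain ⟨hW0, -, hWtop⟩ := h w _ hwpos
        have hmem : w ∈ {w | dist x w ≤ 2 * (a + 1) * infDist w Ωᶜ} := by
          have := dist_triangle x p w
          rw [dist_comm p w] at this
          simp only [mem_ofPred_eq]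
          nlinarith
        rw [indicator_of_mem hmem]
        have hle : μ (ball w (infDist w Ωᶜ)) ≤ D ^ m * μ (ball p r) := by
          refine (measure_mono (ball_subset_ball' ?_)).trans
            (measure_ball_two_pow_mul_le (fun x r hr => (h x r hr).2.1) p hr0 m)
          calc infDist w Ωᶜ + dist w p ≤ 2 * infDist p Ωᶜ := by linarith
            _ ≤ 2 ^ m * ε * infDist p Ωᶜ := by gcongr
            _ = 2 ^ m * r := by rw [hr]; ring
        calc f w = μ (ball w (infDist w Ωᶜ)) * (f w / μ (ball w (infDist w Ωᶜ))) :=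
              (ENNReal.mul_div_cancel hW0.ne' hWtop.ne).symm
          _ ≤ _ := by gcongr
    _ ≤ D ^ m * μ (ball p r) * ∫⁻ w in ball p r,
          {w | dist x w ≤ 2 * (a + 1) * infDist w Ωᶜ}.indicator
            (fun w => f w / μ (ball w (infDist w Ωᶜ))) w ∂μ := by
        rw [lintegral_const_mul' _ _ (ENNReal.mul_ne_top (ENNReal.pow_ne_top hD) hBtop.ne)]
    _ ≤ D ^ m * μ (ball p r) * whitneyPotential μ Ω (2 * (a + 1)) f x := by
        gcongr
        exact lintegral_mono_set hsub
    _ = _ := by ring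

end HajlaszLoc

/-- On a uniform domain `Ω` in a complete metric space with a doubling
measure, `M^{1,1}_{c_H}(Ω) = M^{1,1}(Ω)` with equivalent norms: there is `C ≥ 1`
depending only on `C_d, c_U, c_H` such that every restricted admissible gradient for
`u` yields a full admissible gradient with comparable `L¹` norm (and conversely, every
full admissible gradient is trivially a restricted one). -/
theorem hajlaszLoc_eq_hajlasz (C_d cU cH : ℝ) (hCd : 1 ≤ C_d)
    (hcU : cU ∈ Set.Ioc (0 : ℝ) 1) (hcH : cH ∈ Set.Ioo (0 : ℝ) 1) :
    ∃ C ≥ (1 : ℝ), ∀ (X : Type) [MetricSpace X] [CompleteSpace X] [MeasurableSpace X]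
      [BorelSpace X] (μ : Measure X),
      (∀ (x : X) (r : ℝ), 0 < r →
        0 < μ (ball x r) ∧ μ (ball x (2 * r)) ≤ ENNReal.ofReal C_d * μ (ball x r) ∧
          μ (ball x r) < ⊤) →
      ∀ (Ω : Set X), IsOpen Ω → IsConnected Ω → Ωᶜ.Nonempty →
        IsUniformDomain Ω cU →
      ∀ u : X → ℝ, IntegrableOn u Ω μ →
        ((∀ g : X → ℝ, HajlaszAdmissibleLoc μ Ω cH u g →
          ∃ g' : X → ℝ, HajlaszAdmissible μ Ω u g' ∧
            ∫ p in Ω, |u p| ∂μ + ∫ p in Ω, g' p ∂μ ≤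
              C * (∫ p in Ω, |u p| ∂μ + ∫ p in Ω, g p ∂μ)) ∧
        (∀ g : X → ℝ, HajlaszAdmissible μ Ω u g → HajlaszAdmissibleLoc μ Ω cH u g)) := by
  open Set in
  obtain ⟨hU0, -⟩ := hcU
  have hH0 := hcH.1
  have ha : 0 ≤ cU⁻¹ := inv_nonneg.2 hU0.le
  obtain ⟨m, hm⟩ := pow_unbounded_of_one_lt (2 / (cH / 16)) one_lt_two
  rw [div_lt_iff₀ (by positivity)] at hm
  obtain ⟨k, hk⟩ := pow_unbounded_of_one_lt (2 * (cU⁻¹ + 1)) one_lt_two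
  set C₀ : ℝ := 9 * cU⁻¹ + 1 / cH + 1 with hC₀
  have hC₀1 : 1 ≤ C₀ := by
    have : 0 ≤ 9 * cU⁻¹ + 1 / cH := by positivity
    linarith
  have hCd0 : 0 ≤ C_d := by linarith
  refine ⟨C₀ * (1 + C_d ^ m * C_d ^ k), by
    have : 0 ≤ C_d ^ m * C_d ^ k := by positivity
    nlinarith, ?_⟩
  intro X _ _ _ _ μ hμ Ω hΩ _ hΩc hunif u _
  refine ⟨?_, fun g ⟨h1, h2, A, h3, h4, h5⟩ =>
    ⟨h1, h2, A, h3, h4, fun x hx y hy _ => h5 x hx y hy⟩⟩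
  rintro g ⟨hg0, hgi, A, hAΩ, hA0, hu⟩
  have := sigmaFinite_of_measure_ball_lt_top fun x r hr => (hμ x r hr).2.2
  have := secondCountableTopology_of_measure_ball
    fun x r hr => ⟨(hμ x r hr).1, (hμ x r hr).2.2⟩
  set gm := hgi.1.mk g with hgm
  have hgm_meas : Measurable gm := hgi.1.stronglyMeasurable_mk.measurable
  set f : X → ENNReal := fun z => ENNReal.ofReal (gm z) with hf
  have hf_meas : Measurable f := hgm_meas.ennreal_ofReal
  set G := whitneyPotential μ Ω (2 * (cU⁻¹ + 1)) f
  have hG_meas : Measurable G := measurable_whitneyPotential _ _ hf_meas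
  have hint_f : ∫⁻ z in Ω, f z ∂μ = ENNReal.ofReal (∫ z in Ω, g z ∂μ) := by
    rw [ofReal_integral_eq_lintegral_ofReal hgi (ae_of_all _ hg0)]
    exact lintegral_congr_ae (hgi.1.ae_eq_mk.mono fun z hz => by simp only [hf, hgm, ← hz])
  have hGint : ∫⁻ x in Ω, G x ∂μ ≤
      ENNReal.ofReal C_d ^ k * ENNReal.ofReal (∫ z in Ω, g z ∂μ) :=
    hint_f ▸ lintegral_whitneyPotential_le (fun x r hr => (hμ x r hr).2.1) hΩ hΩc hk hf_meas
  have htop : ENNReal.ofReal C_d ^ k * ENNReal.ofReal (∫ z in Ω, g z ∂μ) ≠ ⊤ :=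
    ENNReal.mul_ne_top (ENNReal.pow_ne_top ENNReal.ofReal_ne_top) ENNReal.ofReal_ne_top
  have hGfin : ∫⁻ x in Ω, G x ∂μ ≠ ⊤ := ne_top_of_le_ne_top htop hGint
  have hGae := ae_lt_top hG_meas hGfin
  have hGi : IntegrableOn (fun x => (G x).toReal) Ω μ :=
    integrable_toReal_of_lintegral_ne_top hG_meas.aemeasurable hGfin
  have hGle : ∫ x in Ω, (G x).toReal ∂μ ≤ C_d ^ k * ∫ z in Ω, g z ∂μ := by
    rw [integral_toReal hG_meas.aemeasurable hGae]
    refine (ENNReal.toReal_mono htop hGint).trans_eq ?_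
    rw [ENNReal.toReal_mul, ENNReal.toReal_pow, ENNReal.toReal_ofReal hCd0,
      ENNReal.toReal_ofReal (integral_nonneg hg0)]
  have hN : μ (A ∪ {z | ¬(z ∈ Ω → g z = gm z)}) = 0 :=
    measure_union_null hA0
      (ae_iff.1 ((ae_restrict_iff' hΩ.measurableSet).1 hgi.1.ae_eq_mk))
  refine ⟨fun x => C₀ * (g x + C_d ^ m * (G x).toReal), ⟨fun x => ?_, ?_, ?_⟩, ?_⟩
  · have := hg0 x
    positivity
  · exact (hgi.add (hGi.const_mul _)).const_mul _
  · refine ⟨A ∪ {x | ¬(x ∈ Ω → G x < ⊤)}, union_subset hAΩ fun x hx => ?_,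
      measure_union_null hA0 (ae_iff.1 ((ae_restrict_iff' hΩ.measurableSet).1 hGae)), ?_⟩
    · by_contra hxΩ
      exact hx fun h => absurd h hxΩ
    rintro x ⟨hxΩ, hx⟩ y ⟨hyΩ, hy⟩
    simp only [mem_union, mem_ofPred_eq, not_or, not_not] at hx hy
    have hxG := (hx.2 hxΩ).ne
    have hyG := (hy.2 hyΩ).ne
    have good : ∀ {w p : X}, G w ≠ ⊤ → p ∈ Ω → dist w p ≤ cU⁻¹ * infDist p Ωᶜ →
        ∃ z ∈ Ω \ A, dist z p ≤ cH / 16 * infDist p Ωᶜ ∧ g z ≤ C_d ^ m * (G w).toReal := by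
      intro w p hw hp hwp
      obtain ⟨z, hz, hzN, hfz⟩ := exists_le_whitneyPotential ENNReal.ofReal_ne_top hμ hΩ hΩc hN
        (ε := cH / 16) (by positivity) (by linarith [hcH.2]) hm.le hf_meas hp ha hwp
      simp only [mem_union, mem_ofPred_eq, not_or, not_not] at hzN
      have hzΩ : z ∈ Ω := ball_infDist_compl_subset (ball_subset_ball (by
        nlinarith [hcH.2, infDist_nonneg (x := p) (s := Ωᶜ)]) hz)
      refine ⟨z, ⟨hzΩ, hzN.1⟩, (mem_ball.1 hz).le, ?_⟩
      rw [hzN.2 hzΩ]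
      have := ENNReal.toReal_mono
        (ENNReal.mul_ne_top (ENNReal.pow_ne_top ENNReal.ofReal_ne_top) hw) hfz
      rw [ENNReal.toReal_mul, ENNReal.toReal_pow, ENNReal.toReal_ofReal hCd0] at this
      refine le_trans ?_ this
      rw [ENNReal.toReal_ofReal']
      exact le_max_left _ _
    set M := (g x + C_d ^ m * (G x).toReal) + (g y + C_d ^ m * (G y).toReal) with hM
    have hgx := hg0 x
    have hgy := hg0 y
    have hGx : 0 ≤ C_d ^ m * (G x).toReal := by positivity
    have hGy : 0 ≤ C_d ^ m * (G y).toReal := by positivity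
    have hM0 : 0 ≤ M := by positivity
    suffices |u x - u y| ≤ C₀ * dist x y * M by
      refine this.trans_eq ?_
      rw [hM]; ring
    by_cases hclose : dist x y ≤ cH * min (infDist x Ωᶜ) (infDist y Ωᶜ)
    · calc |u x - u y| ≤ dist x y * (g x + g y) := hu x ⟨hxΩ, hx.1⟩ y ⟨hyΩ, hy.1⟩ hclose
        _ ≤ 1 * dist x y * M := by
          rw [one_mul]
          gcongr
          linarith
        _ ≤ _ := by gcongr
    rw [not_le] at hclose
    have hxy : x ≠ y := by
      rintro rfl
      have : 0 ≤ cH * min (infDist x Ωᶜ) (infDist x Ωᶜ) :=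
        mul_nonneg hH0.le (le_min infDist_nonneg infDist_nonneg)
      rw [dist_self] at hclose
      linarith
    obtain ⟨γ, L, hL0, hγ0, hγL, hL, hγΩ, hγlip, hγc⟩ := hunif x hxΩ y hyΩ hxy
    have h0mem : (0 : ℝ) ∈ Icc (0 : ℝ) L := ⟨le_rfl, hL0⟩
    have hLmem : L ∈ Icc (0 : ℝ) L := ⟨hL0, le_rfl⟩
    have hdx : ∀ t ∈ Icc (0 : ℝ) L, dist x (γ t) ≤ t := fun t ht => by
      have := hγlip.dist_le_mul 0 h0mem t ht
      simpa [hγ0, Real.dist_eq, abs_of_nonneg ht.1] using this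
    have hdy : ∀ t ∈ Icc (0 : ℝ) L, dist y (γ t) ≤ L - t := fun t ht => by
      have := hγlip.dist_le_mul L hLmem t ht
      simpa [hγL, Real.dist_eq, abs_of_nonneg (sub_nonneg.2 ht.2)] using this
    have hz : ∀ t ∈ Icc (0 : ℝ) L, ∃ z ∈ Ω \ A, dist z (γ t) ≤ cH / 16 * infDist (γ t) Ωᶜ ∧
        g z ≤ M ∧ (t = 0 → z = x) ∧ (t = L → z = y) := by
      intro t ht
      have hδ : 0 ≤ cH / 16 * infDist (γ t) Ωᶜ := mul_nonneg (by positivity) infDist_nonneg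
      have hc := hγc t ht
      by_cases ht0 : t = 0
      · refine ⟨x, ⟨hxΩ, hx.1⟩, ?_, by linarith, fun _ => rfl, fun htL => ?_⟩
        · have : γ t = x := by rw [ht0, hγ0]
          rwa [← this, dist_self]
        · rw [← hγ0, ← hγL, ← ht0, htL]
      by_cases htL : t = L
      · refine ⟨y, ⟨hyΩ, hy.1⟩, ?_, by linarith, fun h => absurd h ht0, fun _ => rfl⟩
        have : γ t = y := by rw [htL, hγL]
        rwa [← this, dist_self]
      rcases le_total t (L - t) with hle | hle
      · rw [min_eq_left hle] at hc
        obtain ⟨z, hzA, hzd, hzg⟩ := good hxG (hγΩ t ht)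
          ((hdx t ht).trans (by rwa [← div_eq_inv_mul, le_div_iff₀' hU0]))
        exact ⟨z, hzA, hzd, by linarith, fun h => absurd h ht0, fun h => absurd h htL⟩
      · rw [min_eq_right hle] at hc
        obtain ⟨z, hzA, hzd, hzg⟩ := good hyG (hγΩ t ht)
          ((hdy t ht).trans (by rwa [← div_eq_inv_mul, le_div_iff₀' hU0]))
        exact ⟨z, hzA, hzd, by linarith, fun h => absurd h ht0, fun h => absurd h htL⟩
    have : Nonempty X := ⟨x⟩
    choose! z hzA hzd hzg hz0 hzL using hz
    obtain ⟨t₀, ht₀, hmin⟩ := isCompact_Icc.exists_isMinOn ⟨0, h0mem⟩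
      ((continuous_infDist_pt Ωᶜ).comp_continuousOn hγlip.continuousOn)
    have hchain := abs_sub_le_of_chain hcH hu hM0 (Δ := infDist x Ωᶜ + L)
      ((hΩ.isClosed_compl.notMem_iff_infDist_pos hΩc).1 fun h => h (hγΩ t₀ ht₀))
      hγlip (fun t ht => hmin ht) (fun t ht => by
        have := infDist_le_infDist_add_dist (s := Ωᶜ) (x := γ t) (y := x)
        rw [dist_comm] at this
        linarith [hdx t ht, ht.2]) hzA hzd hzg hL0
    rw [hz0 0 h0mem rfl, hzL L hLmem rfl, abs_sub_comm] at hchain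
    have hδx : infDist x Ωᶜ ≤ 1 / cH * dist x y + dist x y := by
      have h1 : infDist x Ωᶜ ≤ min (infDist x Ωᶜ) (infDist y Ωᶜ) + dist x y := by
        rw [← min_add_add_right]
        exact le_min (by linarith [dist_nonneg (x := x) (y := y)]) infDist_le_infDist_add_dist
      have h2 : min (infDist x Ωᶜ) (infDist y Ωᶜ) ≤ 1 / cH * dist x y := by
        rw [one_div, ← div_eq_inv_mul, le_div_iff₀' hH0]
        exact hclose.le
      linarith
    calc |u x - u y| ≤ 8 * M * L + M * (infDist x Ωᶜ + L) := hchain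
      _ = (9 * L + infDist x Ωᶜ) * M := by ring
      _ ≤ (9 * (cU⁻¹ * dist x y) + (1 / cH * dist x y + dist x y)) * M := by gcongr
      _ = C₀ * dist x y * M := by rw [hC₀]; ring
  · rw [integral_const_mul, integral_add hgi (hGi.const_mul _), integral_const_mul]
    have hu0 : 0 ≤ ∫ p in Ω, |u p| ∂μ := integral_nonneg fun _ => abs_nonneg _
    have hC1 : 1 ≤ C₀ * (1 + C_d ^ m * C_d ^ k) := by
      have : 0 ≤ C_d ^ m * C_d ^ k := by positivity
      nlinarith
    calc ∫ p in Ω, |u p| ∂μ + C₀ * (∫ p in Ω, g p ∂μ + C_d ^ m * ∫ p in Ω, (G p).toReal ∂μ)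
        ≤ C₀ * (1 + C_d ^ m * C_d ^ k) * ∫ p in Ω, |u p| ∂μ +
          C₀ * (∫ p in Ω, g p ∂μ + C_d ^ m * (C_d ^ k * ∫ p in Ω, g p ∂μ)) := by
          gcongr
          exact le_mul_of_one_le_left hu0 hC1
      _ = _ := by ring
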